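/- arXiv:1202.3013 — 3 statements merged into one kernel-verified Lean document; each statement's English description precedes it below -/
import Mathlib

section
/- There exists a finitely generated monoid M such that (i) for every finite alphabet A and every map φ : A → M whose induced monoid homomorphism φ* : List A → M is surjective, there exists a regular language L ⊆ List A such that φ* restricted to L is a bijection onto M, yet (ii) M is not Markov as a monoid. -/
open Function

/-- A language is regular if it is accepted by a deterministic finite automaton
with a finite state set. -/
def RegularLang {A : Type} (L : Language A) : Prop :=
  ∃ (Q : Type) (_ : Fintype Q) (M : DFA A Q), M.accepts = L

/-- The product of a nonempty word under the letter-assignment `φ`; the empty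
word is sent to `none`. This is the induced map `φ⁺` on nonempty words. -/
def prodPlus {A S : Type} [Semigroup S] (φ : A → S) : List A → Option S
  | [] => none
  | a :: w => some (w.foldl (fun s b => s * φ b) (φ a))

/-- The induced monoid homomorphism `φ*` from the free monoid of words. -/
def monProd {A M : Type} [Monoid M] (φ : A → M) (w : List A) : M :=
  (w.map φ).prod

/-- A semigroup Markov language for `S` over `A` (with respect to `φ`): a regular,
`+`-prefix-closed language of nonempty words mapping bijectively onto `S` under `φ⁺`. -/
structure IsSgMarkovLang {A S : Type} [Semigroup S] (φ : A → S) (L : Language A) : Prop where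
  regular : RegularLang L
  not_empty_mem : [] ∉ L
  plus_prefix_closed : ∀ u v : List A, u ≠ [] → v ≠ [] → u ++ v ∈ L → u ∈ L
  unique_rep : ∀ s : S, ∃! w : List A, w ∈ L ∧ prodPlus φ w = some s

/-- A robust semigroup Markov language: additionally every word of `L` has minimal
length among (nonempty) words representing the same element. -/
structure IsRobustSgMarkovLang {A S : Type} [Semigroup S] (φ : A → S) (L : Language A)
    extends IsSgMarkovLang φ L : Prop where
  min_length : ∀ w ∈ L, ∀ v : List A, prodPlus φ v = prodPlus φ w → w.length ≤ v.length

/-- A monoid Markov language for `M` over `A` (with respect to `φ`): a regular,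
prefix-closed language mapping bijectively onto `M` under `φ*`. -/
structure IsMonMarkovLang {A M : Type} [Monoid M] (φ : A → M) (L : Language A) : Prop where
  regular : RegularLang L
  prefix_closed : ∀ u v : List A, u ++ v ∈ L → u ∈ L
  unique_rep : ∀ m : M, ∃! w : List A, w ∈ L ∧ monProd φ w = m

/-- A robust monoid Markov language: additionally every word of `L` has minimal
length among words representing the same element. -/
structure IsRobustMonMarkovLang {A M : Type} [Monoid M] (φ : A → M) (L : Language A)
    extends IsMonMarkovLang φ L : Prop where
  min_length : ∀ w ∈ L, ∀ v : List A, monProd φ v = monProd φ w → w.length ≤ v.length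

/-- `S` is Markov as a semigroup. -/
def SgMarkov (S : Type) [Semigroup S] : Prop :=
  ∃ (A : Type) (_ : Fintype A) (φ : A → S),
    (∀ s : S, ∃ w : List A, prodPlus φ w = some s) ∧
    ∃ L : Language A, IsSgMarkovLang φ L

/-- `S` is robustly Markov (as a semigroup) with respect to some alphabet. -/
def SgRobustlyMarkov (S : Type) [Semigroup S] : Prop :=
  ∃ (A : Type) (_ : Fintype A) (φ : A → S),
    (∀ s : S, ∃ w : List A, prodPlus φ w = some s) ∧
    ∃ L : Language A, IsRobustSgMarkovLang φ L

/-- `S` is strongly Markov (as a semigroup). -/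
def SgStronglyMarkov (S : Type) [Semigroup S] : Prop :=
  ∀ (A : Type) [Fintype A] (φ : A → S),
    (∀ s : S, ∃ w : List A, prodPlus φ w = some s) →
    ∃ L : Language A, IsRobustSgMarkovLang φ L

/-- `M` is Markov as a monoid. -/
def MonMarkov (M : Type) [Monoid M] : Prop :=
  ∃ (A : Type) (_ : Fintype A) (φ : A → M),
    Surjective (monProd φ) ∧ ∃ L : Language A, IsMonMarkovLang φ L

/-- `M` is robustly Markov (as a monoid) with respect to some alphabet. -/
def MonRobustlyMarkov (M : Type) [Monoid M] : Prop :=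
  ∃ (A : Type) (_ : Fintype A) (φ : A → M),
    Surjective (monProd φ) ∧ ∃ L : Language A, IsRobustMonMarkovLang φ L

/-- `M` is strongly Markov (as a monoid). -/
def MonStronglyMarkov (M : Type) [Monoid M] : Prop :=
  ∀ (A : Type) [Fintype A] (φ : A → M),
    Surjective (monProd φ) →
    ∃ L : Language A, IsRobustMonMarkovLang φ L

/-- The combined property of a monoid `M` from Statement 8: `M` is finitely generated,
admits a regular language of unique representatives over every finite generating
alphabet, yet is not Markov as a monoid. -/
def Stmt8Prop (M : Type) [Monoid M] : Prop :=
  Monoid.FG M ∧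
  (∀ (A : Type) [Fintype A] (φ : A → M),
    Surjective (monProd φ) →
    ∃ L : Language A, RegularLang L ∧
      ∀ m : M, ∃! w : List A, w ∈ L ∧ monProd φ w = m) ∧
  ¬ MonMarkov M

/-!
The monoid is built from an infinite automaton with letters `x, y, c, d`: from the root one may
walk along `x ^ i` or `y ^ n`, and `x ^ i c` enters the `i`-th line while `y ^ n c` enters the
`n ^ 2`-th line; `c` moves along a line, and `d` leads to a nonzero node exactly from the lines
with square index. Words starting with `y` give regular representatives of the latter nodes,
but a prefix-closed language would have to use for them the `x`-representatives of the lines,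
which cannot detect squares.
-/

namespace SquareLines

/-- The letters labelling the automaton. -/
inductive Letter
  | x | y | c | d
  deriving DecidableEq

instance : Fintype Letter := ⟨{.x, .y, .c, .d}, by rintro (_ | _) <;> decide⟩

/-- The nodes of the automaton. `xs i` is reached by `x ^ i`, `ys n` by `y ^ (n + 1)`,
`line i k` by `x ^ i c ^ (k + 1)` and `test n k` by `y ^ n c ^ (k + 1) d`. -/
inductive Node
  | zero
  | xs (i : ℕ)
  | ys (n : ℕ)
  | line (i k : ℕ)
  | test (n k : ℕ)

open Letter Node

/-- The transition function of the automaton. -/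
def step : Node → Letter → Node
  | xs i, x => xs (i + 1)
  | xs 0, y => ys 0
  | xs i, c => line i 0
  | ys n, y => ys (n + 1)
  | ys n, c => line ((n + 1) * (n + 1)) 0
  | line i k, c => line i (k + 1)
  | line i k, d => if i.sqrt * i.sqrt = i then test i.sqrt k else zero
  | _, _ => zero

/-- The action of words on nodes. -/
def act (v : Node) (s : List Letter) : Node := s.foldl step v

@[simp] theorem act_nil (v : Node) : act v [] = v := rfl

@[simp] theorem act_cons (v : Node) (l : Letter) (s : List Letter) :
    act v (l :: s) = act (step v l) s := rfl

theorem act_append (v : Node) (s t : List Letter) : act v (s ++ t) = act (act v s) t :=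
  List.foldl_append

theorem act_concat (v : Node) (s : List Letter) (l : Letter) :
    act v (s ++ [l]) = step (act v s) l := by simp [act_append]

@[simp] theorem act_zero (s : List Letter) : act zero s = zero := by
  induction s with
  | nil => rfl
  | cons l s ih => simpa [step] using ih

/-- The elements of the monoid: words, and nodes of the automaton. -/
inductive Elt
  | word (s : List Letter)
  | node (v : Node)

open Elt

/-- Words act on nodes from the right; any other product involving a node is zero, unless
the left factor is the identity. -/
def mul : Elt → Elt → Elt
  | word s, word t => word (s ++ t)
  | node v, word s => node (act v s)
  | word [], node v => node v
  | word (_ :: _), node _ => node zero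
  | node _, node _ => node zero

instance : Monoid Elt where
  mul := mul
  one := word []
  mul_assoc a b c := by
    change mul (mul a b) c = mul a (mul b c)
    rcases a with (_ | _) | _ <;> rcases b with (_ | _) | _ <;> rcases c with (_ | _) | _ <;>
      simp [mul, act_append, step]
  one_mul a := by
    change mul (word []) a = a
    cases a <;> rfl
  mul_one a := by
    change mul a (word []) = a
    rcases a with (_ | _) | _ <;> simp [mul]

theorem one_def : (1 : Elt) = word [] := rfl

@[simp] theorem word_mul_word (s t : List Letter) : word s * word t = word (s ++ t) := rfl

@[simp] theorem node_mul_word (v : Node) (s : List Letter) :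
    node v * word s = node (act v s) := rfl

@[simp] theorem word_nil_mul_node (v : Node) : word [] * node v = node v := rfl

@[simp] theorem word_cons_mul_node (l : Letter) (s : List Letter) (v : Node) :
    word (l :: s) * node v = node zero := rfl

@[simp] theorem node_mul_node (v v' : Node) : node v * node v' = node zero := rfl

/-! ### Going backwards in the automaton -/

theorem step_eq_xs {v : Node} {l : Letter} {i : ℕ} (h : step v l = xs i) :
    ∃ i', v = xs i' ∧ l = x ∧ i = i' + 1 := by
  unfold step at h
  split at h <;> grind

theorem step_eq_line {v : Node} {l : Letter} {i k : ℕ} (h : step v l = line i k) :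
    (v = xs i ∧ k = 0) ∨ (∃ n, v = ys n ∧ i = (n + 1) * (n + 1) ∧ k = 0) ∨
      ∃ k', v = line i k' ∧ l = c ∧ k = k' + 1 := by
  unfold step at h
  split at h <;> simp_all
  grind

theorem step_eq_test {v : Node} {l : Letter} {n k : ℕ} (h : step v l = test n k) :
    v = line (n * n) k := by
  unfold step at h
  split at h <;> grind

theorem act_eq_xs {v : Node} {s : List Letter} {i : ℕ} (h : act v s = xs i) :
    ∃ i', v = xs i' ∧ s = List.replicate s.length x ∧ i = i' + s.length := by
  induction s using List.reverseRecOn generalizing i with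
  | nil => exact ⟨i, by simpa using h⟩
  | append_singleton s l ih =>
    rw [act_concat] at h
    obtain ⟨i₁, h₁, rfl, rfl⟩ := step_eq_xs h
    obtain ⟨i', rfl, hs, rfl⟩ := ih h₁
    refine ⟨i', rfl, ?_, by simp; omega⟩
    rw [List.length_append, List.length_singleton, List.replicate_succ', ← hs]

@[simp] theorem act_xs_replicate (i r : ℕ) : act (xs i) (List.replicate r x) = xs (i + r) := by
  induction r generalizing i with
  | zero => rfl
  | succ r ih => rw [List.replicate_succ, act_cons, step, ih]; congr 1; omega

theorem act_eq_line_of_not_isSquare {v : Node} {s : List Letter} {i k : ℕ} (hi : ¬IsSquare i)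
    (h : act v s = line i k) :
    (∃ k', v = line i k') ∨ ∃ i', v = xs i' ∧ i ≤ i' + s.length := by
  induction s using List.reverseRecOn generalizing k with
  | nil => exact .inl ⟨k, h⟩
  | append_singleton s l ih =>
    rw [act_concat] at h
    rcases step_eq_line h with ⟨h₁, -⟩ | ⟨n, -, h₁, -⟩ | ⟨k', h₁, -⟩
    · obtain ⟨i', rfl, -, rfl⟩ := act_eq_xs h₁
      exact .inr ⟨i', rfl, by simp⟩
    · exact absurd ⟨_, h₁⟩ hi
    · rcases ih h₁ with h₂ | ⟨i', h₂, h₃⟩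
      · exact .inl h₂
      · exact .inr ⟨i', h₂, by simp; omega⟩

theorem act_eq_line_of_length_le {v : Node} {s : List Letter} {i k : ℕ} (hk : s.length ≤ k)
    (h : act v s = line i k) : ∃ k', v = line i k' := by
  induction s using List.reverseRecOn generalizing k with
  | nil => exact ⟨k, h⟩
  | append_singleton s l ih =>
    rw [act_concat] at h
    simp only [List.length_append, List.length_singleton] at hk
    rcases step_eq_line h with ⟨-, rfl⟩ | ⟨n, -, -, rfl⟩ | ⟨k', h₁, -, rfl⟩
    · omega
    · omega
    · exact ih (by omega) h₁

theorem act_eq_test {v : Node} {s : List Letter} {n k : ℕ} (hs : s ≠ []) (hk : s.length ≤ k)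
    (h : act v s = test n k) : ∃ k', v = line (n * n) k' := by
  obtain ⟨s, l, rfl⟩ := List.eq_nil_or_concat' s |>.resolve_left hs
  rw [act_concat] at h
  simp only [List.length_append, List.length_singleton] at hk
  exact act_eq_line_of_length_le (by omega) (step_eq_test h)

theorem act_xs_add_eq_line {s : List Letter} {i' i k : ℕ} (hi : ¬IsSquare i)
    (h : act (xs i') s = line i k) (m : ℕ) : act (xs (i' + m)) s = line (i + m) k := by
  induction s using List.reverseRecOn generalizing k with
  | nil => simp at h
  | append_singleton s l ih =>
    rw [act_concat] at h ⊢
    rcases step_eq_line h with ⟨h₁, -⟩ | ⟨n, -, h₁, -⟩ | ⟨k', h₁, rfl, rfl⟩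
    · have h₂ := act_eq_xs h₁
      obtain ⟨_, h₂, hs, rfl⟩ := h₂
      cases h₂
      rw [h₁] at h
      rw [hs, act_xs_replicate]
      cases l <;> simp only [step] at h ⊢
      all_goals grind [step]
    · exact absurd ⟨_, h₁⟩ hi
    · rw [ih h₁, step]

theorem act_line_eq_zero {s : List Letter} {i j k n k' : ℕ} (hj : ¬IsSquare j)
    (h : act (line i k) s = test n k') : act (line j k) s = zero := by
  induction s generalizing k with
  | nil => simp at h
  | cons l s ih =>
    cases l
    case c => exact ih h
    case d =>
      have : ¬j.sqrt * j.sqrt = j := fun h => hj ⟨_, h.symm⟩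
      simp [step, this]
    all_goals simp [step] at h

/-! ### Words over a generating alphabet -/

section Words

variable {A : Type} {φ : A → Elt}

@[simp] theorem monProd_nil {A M : Type} [Monoid M] (φ : A → M) : monProd φ [] = 1 := rfl

@[simp] theorem monProd_singleton {A M : Type} [Monoid M] (φ : A → M) (a : A) :
    monProd φ [a] = φ a := by simp [monProd]

theorem monProd_cons {A M : Type} [Monoid M] (φ : A → M) (a : A) (w : List A) :
    monProd φ (a :: w) = φ a * monProd φ w := by simp [monProd]

theorem monProd_append {A M : Type} [Monoid M] (φ : A → M) (u v : List A) :
    monProd φ (u ++ v) = monProd φ u * monProd φ v := by simp [monProd]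

/-- The length of a word, and the index of a node. -/
def size : Elt → ℕ
  | word s => s.length
  | node (xs i) => i
  | node (line i _) => i
  | node (test n _) => n
  | node _ => 0

/-- The last factor of a product that is a nonzero node is the product itself or a word. -/
theorem mul_eq_node {a b : Elt} {v : Node} (h : a * b = node v) (hv : v ≠ zero) :
    b = node v ∨ ∃ v' s, a = node v' ∧ b = word s ∧ act v' s = v := by
  rcases a with (_ | _) | _ <;> rcases b with _ | _ <;> simp_all

theorem exists_split_of_monProd_eq_line {K : ℕ} (hK : ∀ a, size (φ a) ≤ K) {w : List A}
    {i k : ℕ} (hi : ¬IsSquare i) (hiK : K < i) (h : monProd φ w = node (line i k)) :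
    ∃ p q i' t, w = p ++ q ∧ monProd φ p = node (xs i') ∧ i ≤ i' + K ∧
      monProd φ q = word t ∧ act (xs i') t = line i k := by
  induction w using List.reverseRecOn generalizing k with
  | nil => simp [one_def] at h
  | append_singleton w l ih =>
    have hl := hK l
    rw [monProd_append, monProd_singleton] at h
    rcases mul_eq_node h (by simp) with h₁ | ⟨v, s, hv, hs, h₁⟩
    · rw [h₁, size] at hl
      omega
    · rw [hs, size] at hl
      rcases act_eq_line_of_not_isSquare hi h₁ with ⟨k', rfl⟩ | ⟨i', rfl, h₂⟩
      · obtain ⟨p, q, i', t, rfl, hp, hi', hq, ht⟩ := ih hv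
        refine ⟨p, q ++ [l], i', t ++ s, by simp, hp, hi', ?_, ?_⟩
        · simp [monProd_append, hq, hs]
        · rw [act_append, ht, h₁]
      · exact ⟨w, [l], i', s, rfl, hv, by omega, by simp [hs], h₁⟩

theorem exists_split_of_monProd_eq_xs {K : ℕ} (hK : ∀ a, size (φ a) ≤ K) (N : ℕ) {w : List A}
    {i : ℕ} (hi : K + K * N < i) (h : monProd φ w = node (xs i)) :
    ∃ p u i', w = p ++ u ∧ u.length = N ∧ monProd φ p = node (xs i') ∧
      ∀ a ∈ u, ∃ r ≤ K, φ a = word (List.replicate r x) := by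
  induction N generalizing w i with
  | zero => exact ⟨w, [], i, by simpa using h⟩
  | succ N ih =>
    rcases List.eq_nil_or_concat' w with rfl | ⟨w, l, rfl⟩
    · simp [one_def] at h
    have hl := hK l
    rw [Nat.mul_succ] at hi
    rw [monProd_append, monProd_singleton] at h
    rcases mul_eq_node h (by simp) with h₁ | ⟨v, s, hv, hs, h₁⟩
    · rw [h₁, size] at hl
      omega
    · rw [hs, size] at hl
      obtain ⟨i₁, rfl, hsx, rfl⟩ := act_eq_xs h₁
      obtain ⟨p, u, i', rfl, hu, hp, hux⟩ := ih (by omega) hv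
      refine ⟨p, u ++ [l], i', by simp, by simp [hu], hp, ?_⟩
      intro a ha
      rcases List.mem_append.1 ha with ha | ha
      · exact hux a ha
      · rw [List.mem_singleton.1 ha]
        exact ⟨s.length, hl, by rw [hs, ← hsx]⟩

theorem monProd_eq_replicate {K : ℕ} {u : List A}
    (hu : ∀ a ∈ u, ∃ r ≤ K, φ a = word (List.replicate r x)) :
    ∃ r ≤ K * u.length, monProd φ u = word (List.replicate r x) := by
  induction u with
  | nil => exact ⟨0, by simp [one_def]⟩
  | cons a u ih =>
    obtain ⟨r, hr, h⟩ := hu a (by simp)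
    obtain ⟨r', hr', h'⟩ := ih fun b hb => hu b (by simp [hb])
    refine ⟨r + r', ?_, ?_⟩
    · rw [List.length_cons, Nat.mul_succ]
      omega
    · rw [monProd_cons, h, h', word_mul_word, List.replicate_append_replicate]

/-- Representatives of nodes on a line with large non-square index can be pumped. -/
theorem exists_pump {Q : Type} [Fintype Q] {D : DFA A Q} (hL : IsMonMarkovLang φ D.accepts)
    {K : ℕ} (hK : ∀ a, size (φ a) ≤ K) {w : List A} (hw : w ∈ D.accepts) {i k : ℕ}
    (hi : ¬IsSquare i) (hiK : 2 * K + K * Fintype.card Q < i)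
    (h : monProd φ w = node (line i k)) :
    ∃ r, 0 < r ∧ r ≤ K * Fintype.card Q ∧ ∃ W : ℕ → List A,
      ∀ j, D.eval (W j) = D.eval w ∧ monProd φ (W j) = node (line (i + j * r) k) := by
  obtain ⟨p, q, i₁, t, rfl, hp, hi₁, hq, ht⟩ :=
    exists_split_of_monProd_eq_line hK hi (by omega) h
  obtain ⟨p, u, i₀, rfl, hu, hp₀, hux⟩ :=
    exists_split_of_monProd_eq_xs hK (Fintype.card Q) (by omega) hp
  obtain ⟨e, a, b, b', rfl, hlen, hb, ha, hbe, -⟩ :=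
    D.evalFrom_split (s := D.eval p) hu.ge rfl
  obtain ⟨ra, -, ha'⟩ := monProd_eq_replicate (u := a) fun l hl => hux l (by simp [hl])
  obtain ⟨r, hr, hb'⟩ := monProd_eq_replicate (u := b) fun l hl => hux l (by simp [hl])
  obtain ⟨rb, -, hb''⟩ := monProd_eq_replicate (u := b') fun l hl => hux l (by simp [hl])
  have hi₁ : i₁ = i₀ + ra + r + rb := by
    rw [monProd_append, monProd_append, monProd_append, hp₀, ha', hb', hb''] at hp
    simpa [act_append, eq_comm, add_assoc] using hp
  have hr₀ : 0 < r := by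
    rcases Nat.eq_zero_or_pos r with rfl | hr₀
    · refine absurd ((hL.unique_rep (node (xs (i₀ + ra)))).unique
        (y₁ := p ++ a ++ b) (y₂ := p ++ a) ⟨?_, ?_⟩ ⟨?_, ?_⟩) (by simpa using hb)
      · exact hL.prefix_closed _ (b' ++ q) (by simpa using hw)
      · simp [monProd_append, hp₀, ha', hb']
      · exact hL.prefix_closed _ (b ++ (b' ++ q)) (by simpa using hw)
      · simp [monProd_append, hp₀, ha']
    · exact hr₀
  have hpow (j : ℕ) : D.evalFrom e (List.replicate j b).flatten = e ∧
      monProd φ (List.replicate j b).flatten = word (List.replicate (j * r) x) := by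
    induction j with
    | zero => simp [one_def]
    | succ j ih =>
      rw [List.replicate_succ, List.flatten_cons]
      refine ⟨by rw [DFA.evalFrom_of_append, hbe, ih.1], ?_⟩
      rw [monProd_append, ih.2, hb', word_mul_word, List.replicate_append_replicate]
      congr 2
      ring
  refine ⟨r, hr₀, hr.trans (Nat.mul_le_mul_left _ (by omega)),
    fun j => p ++ a ++ b ++ (List.replicate j b).flatten ++ b' ++ q, fun j => ⟨?_, ?_⟩⟩
  · unfold DFA.eval at ha ⊢
    simp only [DFA.evalFrom_of_append, ha, hbe, (hpow j).1]
  · simp only [monProd_append, hp₀, ha', hb', hb'', hq, (hpow j).2, node_mul_word,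
      act_xs_replicate]
    rw [← act_xs_add_eq_line hi ht, hi₁]
    congr 3
    ring

end Words

theorem not_isSquare_of_lt {n m : ℕ} (h₁ : n * n < m) (h₂ : m < (n + 1) * (n + 1)) :
    ¬IsSquare m := by
  rintro ⟨r, rfl⟩
  have := Nat.mul_self_lt_mul_self_iff.1 h₁
  have := Nat.mul_self_lt_mul_self_iff.1 h₂
  omega

theorem not_monMarkov : ¬MonMarkov Elt := by
  rintro ⟨A, _, φ, -, L, hL⟩
  obtain ⟨Q, _, D, rfl⟩ := hL.regular
  obtain ⟨K, hK⟩ : ∃ K, ∀ a, size (φ a) ≤ K :=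
    ⟨Finset.univ.sup fun a => size (φ a),
      fun a => Finset.le_sup (f := fun a => size (φ a)) (by simp)⟩
  set B := K * Fintype.card Q with hB
  set P := B.factorial with hP
  obtain ⟨n, hn⟩ : ∃ n, n = 2 * K + 2 * B + P + 2 := ⟨_, rfl⟩
  have hPB : 0 < P := Nat.factorial_pos B
  have hnn : (n - 1 + 1) * (n - 1 + 1) = n * n := by rw [Nat.sub_add_cancel (by omega)]
  have hn₁ : (n - 1) * (n - 1) + n + n = n * n + 1 := by
    rw [← hnn, show n = n - 1 + 1 by omega]
    simp only [Nat.add_sub_cancel]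
    ring
  have hn₂ : n * 2 ≤ n * n := Nat.mul_le_mul_left _ (by omega)
  obtain ⟨w, hw, hwn⟩ := (hL.unique_rep (node (test n K))).exists
  obtain ⟨w, l, rfl⟩ : ∃ w' l, w = w' ++ [l] := by
    rcases List.eq_nil_or_concat' w with rfl | h
    · simp [one_def] at hwn
    · exact h
  have hl := hK l
  have hmul := hwn
  rw [monProd_append, monProd_singleton] at hmul
  rcases mul_eq_node hmul (by simp) with h₁ | ⟨v, s, hv, hs, h₁⟩
  · rw [h₁, size] at hl
    omega
  have hwL := hL.prefix_closed _ _ hw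
  have hs₀ : s ≠ [] := by
    rintro rfl
    have := (hL.unique_rep _).unique ⟨hw, hwn⟩ ⟨hwL, by rw [hv, ← h₁, act_nil]⟩
    simp at this
  rw [hs, size] at hl
  obtain ⟨k, rfl⟩ := act_eq_test hs₀ hl h₁
  obtain ⟨w₀, hw₀, hwn₀⟩ := (hL.unique_rep (node (line (n * n - P) k))).exists
  obtain ⟨r, hr, hrB, W, hW⟩ := exists_pump hL hK hw₀
    (not_isSquare_of_lt (n := n - 1) (by omega) (by omega)) (by omega) hwn₀
  obtain ⟨j, hj⟩ : r ∣ P := Nat.dvd_factorial hr hrB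
  have hWL (m : ℕ) : W m ∈ D.accepts := by
    rw [DFA.mem_accepts, (hW m).1]
    exact hw₀
  have hindex (m : ℕ) : n * n - P + (j + m) * r = n * n + m * r := by
    rw [add_mul, mul_comm j, ← hj]
    omega
  have hWj : W j = w := by
    refine (hL.unique_rep _).unique ⟨hWL j, (hW j).2⟩ ⟨hwL, ?_⟩
    have := hindex 0
    rw [add_zero, zero_mul, add_zero] at this
    rw [this, hv]
  have hzero (m : ℕ) (hm₀ : 0 < m) (hm : m ≤ 2) :
      W (j + m) ++ [l] ∈ D.accepts ∧ monProd φ (W (j + m) ++ [l]) = node zero := by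
    constructor
    · rw [DFA.mem_accepts, DFA.eval_append_singleton, (hW _).1, ← (hW j).1, hWj,
        ← DFA.eval_append_singleton]
      exact hw
    · have h₂ : m * r ≤ 2 * B := Nat.mul_le_mul hm hrB
      have h₃ : 0 < m * r := Nat.mul_pos hm₀ hr
      have h₄ : (n + 1) * (n + 1) = n * n + 2 * n + 1 := by ring
      rw [monProd_append, monProd_singleton, (hW _).2, hs, node_mul_word, hindex]
      exact congrArg node (act_line_eq_zero
        (not_isSquare_of_lt (n := n) (by omega) (by omega)) h₁)
  have heq := (hL.unique_rep _).unique (hzero 1 (by simp) (by simp)) (hzero 2 (by simp) (by simp))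
  have := (hW (j + 1)).2
  rw [List.append_cancel_right heq, (hW (j + 2)).2, hindex, hindex] at this
  simp at this
  omega

/-! ### A regular cross-section -/

/-- The standard generators: `none` is the root of the automaton. -/
def gen : Option Letter → Elt
  | none => node (xs 0)
  | some l => word [l]

/-- The power of a letter, as a word over the standard generators. -/
abbrev pow (l : Letter) (n : ℕ) : List (Option Letter) := List.replicate n (some l)

/-- Normal forms over the standard generators. -/
def nf : Elt → List (Option Letter)
  | word s => s.map some
  | node zero => [none, some d]
  | node (xs i) => none :: pow x i
  | node (ys n) => none :: pow y (n + 1)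
  | node (line i k) => none :: (pow x i ++ pow c (k + 1))
  | node (test n k) => none :: (pow y n ++ pow c (k + 1) ++ [some d])

theorem monProd_gen_map_some (s : List Letter) : monProd gen (s.map some) = word s := by
  induction s with
  | nil => rfl
  | cons l s ih => rw [List.map_cons, monProd_cons, ih]; rfl

theorem monProd_gen_pow (l : Letter) (n : ℕ) :
    monProd gen (pow l n) = word (List.replicate n l) := by
  rw [pow, ← List.map_replicate, monProd_gen_map_some]

theorem act_ys_replicate (n r : ℕ) : act (ys n) (List.replicate r y) = ys (n + r) := by
  induction r generalizing n with
  | zero => rfl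
  | succ r ih => rw [List.replicate_succ, act_cons, step, ih]; congr 1; omega

theorem act_line_replicate (i k r : ℕ) : act (line i k) (List.replicate r c) = line i (k + r) := by
  induction r generalizing k with
  | zero => rfl
  | succ r ih => rw [List.replicate_succ, act_cons, step, ih]; congr 1; omega

theorem act_root_ys_line (n : ℕ) :
    act (xs 0) (List.replicate n y ++ [c]) = line (n * n) 0 := by
  cases n with
  | zero => rfl
  | succ n => simp [act_append, List.replicate_succ, step, act_ys_replicate]

theorem monProd_gen_nf (m : Elt) : monProd gen (nf m) = m := by
  rcases m with s | (_ | i | n | ⟨i, k⟩ | ⟨n, k⟩)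
  · exact monProd_gen_map_some s
  · rfl
  · simp [nf, monProd_cons, monProd_gen_pow, gen]
  · simp [nf, monProd_cons, monProd_gen_pow, gen, List.replicate_succ, step, act_ys_replicate]
  · simp only [nf, monProd_cons, monProd_append, monProd_gen_pow, gen, List.replicate_succ]
    simp [act_append, step, act_line_replicate]
  · simp only [nf, monProd_cons, monProd_append, monProd_gen_pow, gen,
      monProd_nil, List.replicate_succ, mul_one, word_mul_word, node_mul_word]
    rw [← List.append_assoc (List.replicate n y),
      act_append, act_append, act_root_ys_line, act_line_replicate]
    simp [step, Nat.sqrt_eq]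

/-- The states of an automaton accepting the normal forms. -/
inductive State
  | start | word | root | x | y | c | xc | yc | last | fail
  deriving DecidableEq

instance : Fintype State :=
  ⟨{.start, .word, .root, .x, .y, .c, .xc, .yc, .last, .fail}, by rintro (_ | _) <;> decide⟩

/-- An automaton accepting the normal forms. -/
def nfDFA : DFA (Option Letter) State where
  step
    | .start, none => .root
    | .start, some _ => .word
    | .word, some _ => .word
    | .root, some x => .x
    | .root, some y => .y
    | .root, some c => .c
    | .root, some d => .last
    | .x, some x => .x
    | .x, some c => .xc
    | .y, some y => .y
    | .y, some c => .yc
    | .c, some c => .c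
    | .c, some d => .last
    | .xc, some c => .xc
    | .yc, some c => .yc
    | .yc, some d => .last
    | _, _ => .fail
  start := .start
  accept := {.start, .word, .root, .x, .y, .c, .xc, .last}

/-- The words leading to a given state. -/
def State.Reaches : State → List (Option Letter) → Prop
  | .start, w => w = []
  | .word, w => ∃ s, w = List.map some s
  | .root, w => w = [none]
  | .x, w => ∃ i, w = none :: pow Letter.x i
  | .y, w => ∃ n, w = none :: pow Letter.y (n + 1)
  | .c, w => ∃ k, w = none :: pow Letter.c (k + 1)
  | .xc, w => ∃ i k, w = none :: (pow Letter.x i ++ pow Letter.c (k + 1))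
  | .yc, w => ∃ n k, w = none :: (pow Letter.y n ++ pow Letter.c (k + 1))
  | .last, w => w = [none, some d] ∨
      ∃ n k, w = none :: (pow Letter.y n ++ pow Letter.c (k + 1) ++ [some d])
  | .fail, _ => True

theorem reaches_eval (w : List (Option Letter)) : (nfDFA.eval w).Reaches w := by
  induction w using List.reverseRecOn with
  | nil => rfl
  | append_singleton w g ih =>
    rw [DFA.eval_append_singleton]
    generalize nfDFA.eval w = q at ih
    have hpow (l : Letter) (n : ℕ) : pow l (n + 1) = pow l n ++ [some l] := List.replicate_succ'
    rcases g with _ | l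
    · cases q <;> simp_all [nfDFA, State.Reaches]
    cases q
    case start => exact ⟨[l], by rw [show w = [] from ih]; rfl⟩
    case word =>
      obtain ⟨s, rfl⟩ := ih
      exact ⟨s ++ [l], by simp⟩
    case root =>
      obtain rfl : w = [none] := ih
      cases l
      · exact ⟨1, rfl⟩
      · exact ⟨0, rfl⟩
      · exact ⟨0, rfl⟩
      · exact .inl rfl
    case x =>
      obtain ⟨i, rfl⟩ := ih
      cases l <;> try trivial
      · exact ⟨i + 1, by simp [hpow]⟩
      · exact ⟨i, 0, by simp⟩
    case y =>
      obtain ⟨n, rfl⟩ := ih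
      cases l <;> try trivial
      · exact ⟨n + 1, by simp [hpow]⟩
      · exact ⟨n + 1, 0, by simp⟩
    case c =>
      obtain ⟨k, rfl⟩ := ih
      cases l <;> try trivial
      · exact ⟨k + 1, by simp [hpow]⟩
      · exact .inr ⟨0, k, by simp⟩
    case xc =>
      obtain ⟨i, k, rfl⟩ := ih
      cases l <;> try trivial
      exact ⟨i, k + 1, by simp [hpow]⟩
    case yc =>
      obtain ⟨n, k, rfl⟩ := ih
      cases l <;> try trivial
      · exact ⟨n, k + 1, by simp [hpow]⟩
      · exact .inr ⟨n, k, by simp⟩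
    all_goals trivial

theorem evalFrom_pow {q : State} {l : Letter} (h : nfDFA.step q (some l) = q) (n : ℕ) :
    nfDFA.evalFrom q (pow l n) = q := by
  induction n with
  | zero => rfl
  | succ n ih => rw [pow, List.replicate_succ, DFA.evalFrom_cons, h, ih]

theorem evalFrom_pow_succ {q q' : State} {l : Letter} (h : nfDFA.step q (some l) = q')
    (h' : nfDFA.step q' (some l) = q') (n : ℕ) : nfDFA.evalFrom q (pow l (n + 1)) = q' := by
  rw [pow, List.replicate_succ, DFA.evalFrom_cons, h, evalFrom_pow h']

theorem nf_mem_accepts (m : Elt) : nf m ∈ nfDFA.accepts := by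
  change nfDFA.evalFrom .start (nf m) ∈ nfDFA.accept
  rcases m with s | (_ | i | n | ⟨i, k⟩ | ⟨n, k⟩)
  · have hword (s : List Letter) : nfDFA.evalFrom .word (s.map some) = .word := by
      induction s with
      | nil => rfl
      | cons l s ih => exact ih
    cases s with
    | nil => simp [nf, nfDFA]
    | cons l s =>
      rw [nf, List.map_cons, DFA.evalFrom_cons, show nfDFA.step .start (some l) = .word from rfl,
        hword]
      simp [nfDFA]
  all_goals
    simp only [nf, DFA.evalFrom_cons, DFA.evalFrom_of_append, DFA.evalFrom_nil,
      show nfDFA.step .start none = .root from rfl]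
  · simp [nfDFA]
  · cases i with
    | zero => simp [nfDFA]
    | succ i => rw [evalFrom_pow_succ (q' := .x) rfl rfl]; simp [nfDFA]
  · rw [evalFrom_pow_succ (q' := .y) rfl rfl]; simp [nfDFA]
  · cases i with
    | zero =>
      rw [pow, List.replicate_zero, DFA.evalFrom_nil, evalFrom_pow_succ (q' := .c) rfl rfl]
      simp [nfDFA]
    | succ i =>
      rw [evalFrom_pow_succ (l := x) (q' := .x) rfl rfl, evalFrom_pow_succ (q' := .xc) rfl rfl]
      simp [nfDFA]
  · cases n with
    | zero =>
      rw [pow, List.replicate_zero, DFA.evalFrom_nil, evalFrom_pow_succ (q' := .c) rfl rfl]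
      simp [nfDFA]
    | succ n =>
      rw [evalFrom_pow_succ (l := y) (q' := .y) rfl rfl, evalFrom_pow_succ (q' := .yc) rfl rfl]
      simp [nfDFA]

theorem accepts_nfDFA : nfDFA.accepts = Set.range nf := by
  refine Set.ext fun w => ⟨fun hw => ?_, ?_⟩
  · have hr := reaches_eval w
    have hacc : nfDFA.eval w ∈ nfDFA.accept := hw
    generalize nfDFA.eval w = q at hr hacc
    cases q <;> simp only [State.Reaches] at hr
    case start => exact ⟨.word [], hr.symm⟩
    case word => exact hr.elim fun s hs => ⟨.word s, hs.symm⟩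
    case root => exact ⟨node (xs 0), hr.symm⟩
    case x => exact hr.elim fun i hi => ⟨node (xs i), hi.symm⟩
    case y => exact hr.elim fun n hn => ⟨node (ys n), hn.symm⟩
    case c => exact hr.elim fun k hk => ⟨node (line 0 k), hk.symm⟩
    case xc =>
      obtain ⟨i, k, rfl⟩ := hr
      exact ⟨node (line i k), rfl⟩
    case last =>
      rcases hr with rfl | ⟨n, k, rfl⟩
      · exact ⟨node zero, rfl⟩
      · exact ⟨node (test n k), rfl⟩
    all_goals simp [nfDFA] at hacc
  · rintro ⟨m, rfl⟩
    exact nf_mem_accepts m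

theorem RegularLang.map {A B : Type} {L : Language A} (hL : RegularLang L) {f : A → B}
    (hf : Injective f) : RegularLang (List.map f '' L : Set (List B)) := by
  classical
  obtain ⟨Q, _, D, rfl⟩ := hL
  let D' : DFA B (Option Q) :=
    { step := fun q b => q.bind fun q => (partialInv f b).map (D.step q)
      start := some D.start
      accept := some '' D.accept }
  have heval (w : List A) : D'.eval (w.map f) = some (D.eval w) := by
    induction w using List.reverseRecOn with
    | nil => rfl
    | append_singleton w a ih =>
      rw [List.map_append, List.map_singleton, DFA.eval_append_singleton, ih,
        DFA.eval_append_singleton]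
      simp [D', partialInv_left hf]
  have hmap (w : List B) (q : Q) (h : D'.eval w = some q) : ∃ v : List A, v.map f = w := by
    induction w using List.reverseRecOn generalizing q with
    | nil => exact ⟨[], rfl⟩
    | append_singleton w b ih =>
      rw [DFA.eval_append_singleton] at h
      obtain ⟨q', hq', h⟩ := Option.bind_eq_some_iff.1 h
      obtain ⟨a, ha, -⟩ := Option.map_eq_some_iff.1 h
      obtain ⟨v, rfl⟩ := ih q' hq'
      exact ⟨v ++ [a], by simp [(hf.isPartialInv a b).1 ha]⟩
  refine ⟨Option Q, inferInstance, D', Set.ext fun w => ?_⟩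
  constructor
  · rintro ⟨q, hq, h⟩
    obtain ⟨v, rfl⟩ := hmap w q h.symm
    refine ⟨v, ?_, rfl⟩
    have := h.trans (heval v)
    rw [Option.some_inj] at this
    change D.eval v ∈ D.accept
    rwa [← this]
  · rintro ⟨v, hv, rfl⟩
    exact ⟨_, hv, (heval v).symm⟩

/-- The standard generators cannot be decomposed. -/
theorem eq_gen_of_mul_eq_gen {a b : Elt} {g : Option Letter} (h : a * b = gen g) :
    a = gen g ∨ b = gen g := by
  rcases g with _ | l
  · rcases mul_eq_node h (by simp) with h | ⟨v, s, rfl, rfl, h₁⟩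
    · exact .inr h
    · obtain ⟨i, rfl, -, h₂⟩ := act_eq_xs h₁
      exact .inl (by rw [gen, show i = 0 by omega])
  · rcases a with (_ | _) | _ <;> rcases b with _ | _ <;> simp_all [gen]

theorem exists_letter_eq_gen {A : Type} {φ : A → Elt} (hφ : Surjective (monProd φ))
    (g : Option Letter) : ∃ a, φ a = gen g := by
  obtain ⟨w, hw⟩ := hφ (gen g)
  induction w with
  | nil => rcases g with _ | l <;> simp [one_def, gen] at hw
  | cons a w ih =>
    rw [monProd_cons] at hw
    exact (eq_gen_of_mul_eq_gen hw).elim (fun h => ⟨a, h⟩) ih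

theorem gen_injective : Injective gen := by
  rintro (_ | _) (_ | _) h <;> simp_all [gen]

theorem exists_regular_crossSection {A : Type} {φ : A → Elt} (hφ : Surjective (monProd φ)) :
    ∃ L : Language A, RegularLang L ∧ ∀ m : Elt, ∃! w : List A, w ∈ L ∧ monProd φ w = m := by
  choose f hf using exists_letter_eq_gen hφ
  have hprod (m : Elt) : monProd φ ((nf m).map f) = m := by
    conv_rhs => rw [← monProd_gen_nf m]
    rw [monProd, List.map_map, show φ ∘ f = gen from funext hf, monProd]
  have hfinj : Injective f := fun a b h => gen_injective (by rw [← hf, ← hf, h])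
  refine ⟨_, RegularLang.map ⟨State, inferInstance, nfDFA, rfl⟩ hfinj, fun m => ?_⟩
  rw [accepts_nfDFA]
  refine ⟨(nf m).map f, ⟨⟨_, ⟨m, rfl⟩, rfl⟩, hprod m⟩, ?_⟩
  rintro _ ⟨⟨_, ⟨m', rfl⟩, rfl⟩, h⟩
  rw [hprod] at h
  rw [h]

theorem fg : Monoid.FG Elt := by
  refine Monoid.fg_of_surjective (FreeMonoid.lift gen) fun m => ⟨FreeMonoid.ofList (nf m), ?_⟩
  rw [FreeMonoid.lift_apply, FreeMonoid.toList_ofList]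
  exact monProd_gen_nf m

end SquareLines

/-- There is a finitely generated non-Markov monoid that nevertheless admits a regular
language of unique representatives over every finite generating alphabet. -/
theorem stmt8 : ∃ (M : Type) (inst : Monoid M), @Stmt8Prop M inst :=
  ⟨SquareLines.Elt, inferInstance, SquareLines.fg,
    fun _ _ _ hφ => SquareLines.exists_regular_crossSection hφ, SquareLines.not_monMarkov⟩
end

section
/- There exists a finitely generated monoid that is Markov as a monoid but is not robustly Markov: it does not admit a robust monoid Markov language over any finite alphabet A and map φ : A → M with φ* surjective. -/
open Function

/-- Elements of the monoid with zero generated by `x`, `y`, `z`, `t` in which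
`y * x = x`, `z * y = z`, `t * y = t`, all products that put a letter other than `y` before `x`
or after one of `z`, `t` vanish, and `x * y ^ k * t = x * y ^ (k ^ 2) * z`.
Here `right false n` is `y ^ n * z`, `right true n` is `y ^ n * t`, and `full n` is
`x * y ^ n * z`. -/
inductive ShortcutMonoid : Type
  | mid (n : ℕ)
  | left (n : ℕ)
  | right (c : Bool) (n : ℕ)
  | full (n : ℕ)
  | zero

namespace ShortcutMonoid

/-- Product in the monoid. -/
def mul : ShortcutMonoid → ShortcutMonoid → ShortcutMonoid
  | mid a, mid b => mid (a + b)
  | mid _, left b => left b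
  | mid a, right c b => right c (a + b)
  | mid _, full b => full b
  | left a, mid b => left (a + b)
  | left a, right c b => full (if c then (a + b) ^ 2 else a + b)
  | right c a, mid _ => right c a
  | full a, mid _ => full a
  | _, _ => zero

theorem mul_assoc' (p q r : ShortcutMonoid) : mul (mul p q) r = mul p (mul q r) := by
  cases p <;> cases q <;> cases r <;> simp [mul, Nat.add_assoc]

instance : Monoid ShortcutMonoid where
  mul := mul
  mul_assoc := mul_assoc'
  one := mid 0
  one_mul p := by change mul (mid 0) p = p; cases p <;> simp [mul]
  mul_one p := by change mul p (mid 0) = p; cases p <;> simp [mul]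

theorem mul_def (p q : ShortcutMonoid) : p * q = mul p q := rfl

theorem one_def : (1 : ShortcutMonoid) = mid 0 := rfl

theorem mid_pow (s j : ℕ) : mid s ^ j = mid (j * s) := by
  induction j with
  | zero => simp [one_def]
  | succ j ih => rw [pow_succ, ih, mul_def, mul, Nat.succ_mul]

/-- The exponent of `y` in the normal form of an element. -/
def exponent : ShortcutMonoid → ℕ
  | mid n => n
  | left n => n
  | right _ n => n
  | full n => n
  | zero => 0

/-- The exponent of `y`, except that the elements `x * y ^ n * z` have weight zero. -/
def weight : ShortcutMonoid → ℕ
  | mid n => n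
  | left n => n
  | right _ n => n
  | full _ => 0
  | zero => 0

theorem weight_mul_le (p q : ShortcutMonoid) : (p * q).weight ≤ p.weight + q.weight := by
  rw [mul_def]
  cases p <;> cases q <;> simp [mul, weight]

/-- Generators of the monoid; `o` stands for the zero. -/
inductive Letter : Type
  | x
  | y
  | z (c : Bool)
  | o
  deriving Fintype

/-- The element represented by a letter. -/
def Letter.toElement : Letter → ShortcutMonoid
  | x => left 0
  | y => mid 1
  | z c => right c 0
  | o => zero

open Letter

/-- The chosen word representing an element. -/
def normalForm : ShortcutMonoid → List Letter
  | mid n => List.replicate n y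
  | left n => x :: List.replicate n y
  | right c n => List.replicate n y ++ [z c]
  | full n => x :: (List.replicate n y ++ [z false])
  | zero => [o]

theorem monProd_normalForm (m : ShortcutMonoid) : monProd toElement (normalForm m) = m := by
  cases m <;> simp [monProd, normalForm, toElement, mid_pow, mul_def, mul]

/-- States of the automaton recognizing the normal forms. -/
inductive State : Type
  | start
  | loop
  | left
  | final
  | dead
  deriving DecidableEq

instance : Fintype State where
  elems := {.start, .loop, .left, .final, .dead}
  complete q := by cases q <;> simp

/-- The automaton recognizing the normal forms. -/
def automaton : DFA Letter State where
  step
    | .start, x => .left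
    | .start, y => .loop
    | .start, z _ => .final
    | .start, o => .final
    | .loop, y => .loop
    | .loop, z _ => .final
    | .left, y => .left
    | .left, z false => .final
    | _, _ => .dead
  start := .start
  accept := {q | q ≠ .dead}

theorem evalFrom_dead (w : List Letter) : automaton.evalFrom .dead w = .dead := by
  induction w with
  | nil => rfl
  | cons a w ih => exact ih

theorem evalFrom_final (w : List Letter) : automaton.evalFrom .final w ≠ .dead ↔ w = [] := by
  cases w with
  | nil => simp
  | cons a w =>
    have h : automaton.evalFrom .final (a :: w) = automaton.evalFrom .dead w := rfl
    simp [h, evalFrom_dead]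

theorem evalFrom_left (w : List Letter) : automaton.evalFrom .left w ≠ .dead ↔
    ∃ n, w = List.replicate n y ∨ w = List.replicate n y ++ [z false] := by
  constructor
  · induction w with
    | nil => exact fun _ => ⟨0, Or.inl rfl⟩
    | cons a w ih =>
      intro h
      match a with
      | x => exact absurd (evalFrom_dead w) h
      | o => exact absurd (evalFrom_dead w) h
      | z true => exact absurd (evalFrom_dead w) h
      | z false =>
        obtain rfl := (evalFrom_final w).1 h
        exact ⟨0, Or.inr rfl⟩
      | y =>
        obtain ⟨n, rfl | rfl⟩ := ih h
        · exact ⟨n + 1, Or.inl rfl⟩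
        · exact ⟨n + 1, Or.inr rfl⟩
  · rintro ⟨n, rfl | rfl⟩
    · induction n with
      | zero => simp
      | succ n ih => exact ih
    · induction n with
      | zero => exact (evalFrom_final []).2 rfl
      | succ n ih => exact ih

theorem evalFrom_loop (w : List Letter) : automaton.evalFrom .loop w ≠ .dead ↔
    ∃ n, w = List.replicate n y ∨ ∃ c, w = List.replicate n y ++ [z c] := by
  constructor
  · induction w with
    | nil => exact fun _ => ⟨0, Or.inl rfl⟩
    | cons a w ih =>
      intro h
      match a with
      | x => exact absurd (evalFrom_dead w) h
      | o => exact absurd (evalFrom_dead w) h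
      | z c =>
        obtain rfl := (evalFrom_final w).1 h
        exact ⟨0, Or.inr ⟨c, rfl⟩⟩
      | y =>
        obtain ⟨n, rfl | ⟨c, rfl⟩⟩ := ih h
        · exact ⟨n + 1, Or.inl rfl⟩
        · exact ⟨n + 1, Or.inr ⟨c, rfl⟩⟩
  · rintro ⟨n, rfl | ⟨c, rfl⟩⟩
    · induction n with
      | zero => simp
      | succ n ih => exact ih
    · induction n with
      | zero => exact (evalFrom_final []).2 rfl
      | succ n ih => exact ih

theorem mem_accepts_iff_ne_dead (w : List Letter) :
    w ∈ automaton.accepts ↔ automaton.evalFrom .start w ≠ .dead := Iff.rfl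

theorem mem_accepts_iff_normalForm (w : List Letter) :
    w ∈ automaton.accepts ↔ ∃ m, normalForm m = w := by
  rw [mem_accepts_iff_ne_dead]
  constructor
  · intro h
    match w with
    | [] => exact ⟨mid 0, rfl⟩
    | x :: w =>
      obtain ⟨n, rfl | rfl⟩ := (evalFrom_left w).1 h
      · exact ⟨left n, rfl⟩
      · exact ⟨full n, rfl⟩
    | y :: w =>
      obtain ⟨n, rfl | ⟨c, rfl⟩⟩ := (evalFrom_loop w).1 h
      · exact ⟨mid (n + 1), rfl⟩
      · exact ⟨right c (n + 1), rfl⟩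
    | z c :: w =>
      obtain rfl := (evalFrom_final w).1 h
      exact ⟨right c 0, rfl⟩
    | o :: w =>
      obtain rfl := (evalFrom_final w).1 h
      exact ⟨zero, rfl⟩
  · rintro ⟨m, rfl⟩
    match m with
    | mid 0 => simp [normalForm]
    | mid (n + 1) => exact (evalFrom_loop _).2 ⟨n, Or.inl rfl⟩
    | left n => exact (evalFrom_left _).2 ⟨n, Or.inl rfl⟩
    | right c 0 => exact (evalFrom_final []).2 rfl
    | right c (n + 1) => exact (evalFrom_loop _).2 ⟨n, Or.inr ⟨c, rfl⟩⟩
    | full n => exact (evalFrom_left _).2 ⟨n, Or.inr rfl⟩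
    | zero => exact (evalFrom_final []).2 rfl

theorem monProd_toElement_surjective : Surjective (monProd toElement) :=
  fun m => ⟨normalForm m, monProd_normalForm m⟩

theorem isMonMarkovLang_accepts : IsMonMarkovLang toElement automaton.accepts where
  regular := ⟨State, inferInstance, automaton, rfl⟩
  prefix_closed u v h := by
    rw [mem_accepts_iff_ne_dead] at h ⊢
    intro hu
    rw [DFA.evalFrom_of_append, hu, evalFrom_dead] at h
    exact h rfl
  unique_rep m := by
    refine ⟨normalForm m, ⟨(mem_accepts_iff_normalForm _).2 ⟨m, rfl⟩, monProd_normalForm m⟩, ?_⟩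
    rintro w ⟨hw, rfl⟩
    obtain ⟨m, rfl⟩ := (mem_accepts_iff_normalForm w).1 hw
    rw [monProd_normalForm]

theorem monMarkov : MonMarkov ShortcutMonoid :=
  ⟨Letter, inferInstance, toElement, monProd_toElement_surjective, _, isMonMarkovLang_accepts⟩

end ShortcutMonoid

theorem monProd_append {A M : Type} [Monoid M] (φ : A → M) (u v : List A) :
    monProd φ (u ++ v) = monProd φ u * monProd φ v := by
  simp [monProd]

theorem monProd_flatten_replicate {A M : Type} [Monoid M] (φ : A → M) (v : List A) (j : ℕ) :
    monProd φ (List.replicate j v).flatten = monProd φ v ^ j := by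
  induction j with
  | zero => simp [monProd]
  | succ j ih => rw [List.replicate_succ, List.flatten_cons, monProd_append, ih, pow_succ']

theorem MonMarkov.fg {M : Type} [Monoid M] (h : MonMarkov M) : Monoid.FG M := by
  obtain ⟨A, _, φ, hφ, -⟩ := h
  refine Monoid.fg_iff.2 ⟨Set.range φ, ?_, Set.finite_range φ⟩
  refine eq_top_iff.2 fun m _ => ?_
  obtain ⟨w, rfl⟩ := hφ m
  refine Submonoid.list_prod_mem _ fun p hp => ?_
  obtain ⟨a, -, rfl⟩ := List.mem_map.1 hp
  exact Submonoid.subset_closure ⟨a, rfl⟩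

/-- Long words of a Markov language can be pumped, and the resulting words represent pairwise
distinct elements. -/
theorem IsMonMarkovLang.exists_pumping {A M : Type} [Monoid M] {φ : A → M} {L : Language A}
    (hL : IsMonMarkovLang φ L) : ∃ N : ℕ, ∀ w ∈ L, N ≤ w.length → ∃ u v t : List A,
      w = u ++ v ++ t ∧ v.length ≤ N ∧
      (∀ j : ℕ, u ++ (List.replicate j v).flatten ++ t ∈ L) ∧
      Injective fun j : ℕ => monProd φ u * monProd φ v ^ j * monProd φ t := by
  obtain ⟨Q, _, D, rfl⟩ := hL.regular
  refine ⟨Fintype.card Q, fun w hw hlen => ?_⟩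
  obtain ⟨u, v, t, rfl, hle, hv, hsub⟩ := D.pumping_lemma hw hlen
  have hmem (j : ℕ) : u ++ (List.replicate j v).flatten ++ t ∈ D.accepts := by
    refine hsub (Language.append_mem_mul (Language.append_mem_mul rfl ?_) rfl)
    refine Language.mem_kstar.2 ⟨List.replicate j v, rfl, fun p hp => ?_⟩
    exact List.eq_of_mem_replicate hp
  refine ⟨u, v, t, rfl, by omega, hmem, fun i j hij => ?_⟩
  have hval (j : ℕ) : monProd φ (u ++ (List.replicate j v).flatten ++ t) =
      monProd φ u * monProd φ v ^ j * monProd φ t := by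
    rw [monProd_append, monProd_append, monProd_flatten_replicate]
  have heq := (hL.unique_rep _).unique ⟨hmem i, hval i⟩ ⟨hmem j, (hval j).trans hij.symm⟩
  have hlen' := congrArg List.length heq
  have hpos : 0 < v.length := List.length_pos_iff.2 hv
  simp only [List.length_append, List.length_flatten, List.map_replicate, List.sum_replicate,
    smul_eq_mul] at hlen'
  exact Nat.eq_of_mul_eq_mul_right hpos (by omega)

namespace ShortcutMonoid

theorem exists_weight_monProd_le {A : Type} [Finite A] (φ : A → ShortcutMonoid) :
    ∃ C : ℕ, ∀ w : List A, (monProd φ w).weight ≤ C * w.length := by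
  obtain ⟨C, hC⟩ := (Set.finite_range fun a => (φ a).weight).bddAbove
  refine ⟨C, fun w => ?_⟩
  induction w with
  | nil => simp [monProd, one_def, weight]
  | cons a w ih =>
    have ha : (φ a).weight ≤ C := hC ⟨a, rfl⟩
    have h := weight_mul_le (φ a) (monProd φ w)
    have hcons : monProd φ (a :: w) = φ a * monProd φ w := by simp [monProd]
    rw [hcons, List.length_cons, Nat.mul_succ]
    omega

theorem exists_exponent_monProd_le {A : Type} [Finite A] (φ : A → ShortcutMonoid) (N : ℕ) :
    ∃ B : ℕ, ∀ w : List A, w.length ≤ N → (monProd φ w).exponent ≤ B := by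
  obtain ⟨B, hB⟩ := ((List.finite_length_le A N).image fun w => (monProd φ w).exponent).bddAbove
  exact ⟨B, fun w hw => hB ⟨w, hw, rfl⟩⟩

/-- The elements `x * y ^ (k ^ 2) * z` have representatives of length linear in `k`. -/
theorem exists_short_rep {A : Type} {φ : A → ShortcutMonoid} (hφ : Surjective (monProd φ)) :
    ∃ E : ℕ, ∀ k : ℕ, 0 < k →
      ∃ w : List A, monProd φ w = full (k ^ 2) ∧ w.length ≤ E * k := by
  obtain ⟨wx, hx⟩ := hφ (left 0)
  obtain ⟨wy, hy⟩ := hφ (mid 1)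
  obtain ⟨wz, hz⟩ := hφ (right true 0)
  refine ⟨wx.length + wy.length + wz.length, fun k hk =>
    ⟨wx ++ (List.replicate k wy).flatten ++ wz, ?_, ?_⟩⟩
  · simp [monProd_append, monProd_flatten_replicate, hx, hy, hz, mid_pow, mul_def, mul]
  · simp only [List.length_append, List.length_flatten, List.map_replicate, List.sum_replicate,
      smul_eq_mul]
    nlinarith

/-- If all products `p * q ^ j * r` are distinct and `p * q * r = x * y ^ i * z`, then
`q` is a power of `y` lying between `x` and one of `z`, `t`. -/
theorem eq_of_injective_pump {p q r : ShortcutMonoid} {i : ℕ}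
    (hinj : Injective fun j : ℕ => p * q ^ j * r) (h : p * q * r = full i) :
    ∃ a s b c, 0 < s ∧ p = left a ∧ q = mid s ∧ r = right c b := by
  have hne : p * q ^ 2 * r ≠ p * q ^ 3 * r := fun h => absurd (hinj h) (by decide)
  simp only [pow_succ, pow_zero, one_mul, mul_def] at h hne
  cases q with
  | mid s =>
    cases p <;> cases r <;> simp [mul] at h hne ⊢
    refine Nat.pos_of_ne_zero ?_
    rintro rfl
    simp at hne
  | _ => simp [mul] at h hne

theorem not_isSquare_sq_sub {k F : ℕ} (hF : 0 < F) (hk : F < k) (q : ℕ) : k ^ 2 - F ≠ q ^ 2 := by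
  intro h
  have hle : F ≤ k ^ 2 := by nlinarith
  have hsum : k ^ 2 = q ^ 2 + F := by omega
  have hlt : q < k := by nlinarith
  nlinarith

theorem not_monRobustlyMarkov : ¬ MonRobustlyMarkov ShortcutMonoid := by
  rintro ⟨A, _, φ, hφ, L, hL⟩
  obtain ⟨N, hN⟩ := hL.toIsMonMarkovLang.exists_pumping
  obtain ⟨C, hC⟩ := exists_weight_monProd_le φ
  obtain ⟨B, hB⟩ := exists_exponent_monProd_le φ N
  obtain ⟨E, hE⟩ := exists_short_rep hφ
  have hF : 0 < B.factorial := B.factorial_pos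
  generalize hk : B.factorial + B + C * E + 2 = k
  obtain ⟨w, ⟨hwL, hw⟩, -⟩ := hL.unique_rep (full (k ^ 2 - B.factorial))
  have hBk : B < k ^ 2 - B.factorial := by
    have : B + B.factorial < k ^ 2 :=
      lt_of_lt_of_le (by omega) (Nat.le_self_pow two_ne_zero k)
    omega
  have hlong : N ≤ w.length := by
    by_contra hlt
    have := hB w (by omega)
    rw [hw] at this
    simp only [exponent] at this
    omega
  obtain ⟨u, v, t, rfl, hv, hmem, hinj⟩ := hN w hwL hlong
  rw [monProd_append, monProd_append] at hw
  obtain ⟨a, s, b, c, hs, hu, hvs, ht⟩ := eq_of_injective_pump hinj hw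
  have hsB : s ≤ B := by simpa [hvs, exponent] using hB v hv
  obtain ⟨d, hd⟩ := Nat.dvd_factorial hs hsB
  rw [hu, hvs, ht] at hw
  simp only [mul_def, mul, full.injEq] at hw
  cases c with
  | true => exact not_isSquare_sq_sub hF (by omega) _ hw.symm
  | false =>
    simp only [Bool.false_eq_true, if_false] at hw
    have hexp : a + (d + 1) * s + b = k ^ 2 := by
      have : (d + 1) * s = B.factorial + s := by rw [hd]; ring
      omega
    have hval : monProd φ (u ++ (List.replicate (d + 1) v).flatten ++ t) = full (k ^ 2) := by
      simp [monProd_append, monProd_flatten_replicate, hu, hvs, ht, mid_pow, mul_def, mul,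
        ← hexp, Nat.add_assoc]
    obtain ⟨w', hw', hlen⟩ := hE k (by omega)
    have hmin := hL.min_length _ (hmem (d + 1)) w' (hw'.trans hval.symm)
    have hleft := hC (u ++ (List.replicate (d + 1) v).flatten)
    have hright := hC t
    rw [monProd_append, monProd_flatten_replicate, hu, hvs, mid_pow] at hleft
    rw [ht] at hright
    rw [List.length_append] at hmin
    simp only [mul_def, mul, weight] at hleft hright
    have : k ^ 2 ≤ C * (E * k) := by
      calc k ^ 2 ≤ C * ((u ++ (List.replicate (d + 1) v).flatten).length + t.length) := by
            rw [Nat.mul_add]; omega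
        _ ≤ C * (E * k) := Nat.mul_le_mul_left C (hmin.trans hlen)
    have hCE : C * E < k := by omega
    nlinarith

end ShortcutMonoid

/-- There is a finitely generated monoid that is Markov as a monoid but not robustly
Markov. -/
theorem stmt10 : ∃ (M : Type) (inst : Monoid M),
    @Monoid.FG M inst ∧ @MonMarkov M inst ∧ ¬ @MonRobustlyMarkov M inst := by
  exact ⟨ShortcutMonoid, inferInstance, ShortcutMonoid.monMarkov.fg, ShortcutMonoid.monMarkov,
    ShortcutMonoid.not_monRobustlyMarkov⟩
end

section
/- There exists a finitely generated monoid M that is robustly Markov with respect to some finite alphabet representing a generating set (i.e., M admits a robust monoid Markov language over some finite alphabet A with φ* surjective) but is not strongly Markov: there is some finite alphabet B and map ψ : B → M with ψ* surjective such that M admits no robust monoid Markov language over B. -/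
open Function

namespace RobustMarkov

/-- The disjoint union of a monoid `N` and an `N`-set `T`. It is a monoid when `N` acts on `T` from
the left and every element of `T` is a left zero. -/
inductive ActionSum (N T : Type) : Type
  | scalar (n : N)
  | point (t : T)

namespace ActionSum

variable {N T : Type} [Monoid N] [MulAction N T]

instance : Monoid (ActionSum N T) where
  mul
    | scalar m, scalar n => scalar (m * n)
    | scalar m, point t => point (m • t)
    | point t, _ => point t
  one := scalar 1
  mul_assoc := by
    rintro (m | t) (n | s) (p | r)
    · exact congrArg scalar (mul_assoc m n p)
    · exact congrArg point (mul_smul m n r)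
    all_goals rfl
  one_mul := by
    rintro (m | t)
    · exact congrArg scalar (one_mul m)
    · exact congrArg point (one_smul N t)
  mul_one := by
    rintro (m | t)
    · exact congrArg scalar (mul_one m)
    · rfl

theorem one_def : (1 : ActionSum N T) = scalar 1 := rfl

@[simp] theorem scalar_mul_scalar (m n : N) :
    (scalar m * scalar n : ActionSum N T) = scalar (m * n) := rfl

@[simp] theorem scalar_mul_point (m : N) (t : T) :
    (scalar m * point t : ActionSum N T) = point (m • t) := rfl

@[simp] theorem point_mul (t : T) (x : ActionSum N T) : point t * x = point t := by
  cases x <;> rfl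

end ActionSum

open ActionSum

/-- Words under construction and words that are sealed, so that they cannot change any more. -/
inductive State : Type
  | building (w : List Bool)
  | closed (w : List Bool)

open State

/-- The letter `inl c` prepends `c` to a word under construction; `inr false` seals it as it is and
`inr true` seals it with its letters exchanged. -/
def step : Bool ⊕ Bool → State → State
  | Sum.inl c, building w => building (c :: w)
  | Sum.inr f, building w => closed (bif f then w.map not else w)
  | _, closed w => closed w

instance : MulAction (FreeMonoid (Bool ⊕ Bool)) State := FreeMonoid.mkMulAction step

/-- The monoid that is robustly Markov for one generating set only. -/
abbrev Carrier : Type := ActionSum (FreeMonoid (Bool ⊕ Bool)) State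

theorem monProd_cons {A M : Type} [Monoid M] (φ : A → M) (a : A) (w : List A) :
    monProd φ (a :: w) = φ a * monProd φ w := by
  simp [monProd]

theorem monProd_nil {A M : Type} [Monoid M] (φ : A → M) : monProd φ [] = 1 := rfl

theorem fg_of_surjective_monProd {A M : Type} [Finite A] [Monoid M] {φ : A → M}
    (h : Surjective (monProd φ)) : Monoid.FG M := by
  refine Monoid.fg_of_surjective (FreeMonoid.lift φ) fun m => ?_
  obtain ⟨w, rfl⟩ := h m
  exact ⟨FreeMonoid.ofList w, by simp [monProd, FreeMonoid.lift_apply]⟩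

/-! ### The generating set with a robust Markov language -/

/-- The letters together with the empty word under construction. -/
def gen : Option (Bool ⊕ Bool) → Carrier
  | none => point (building [])
  | some l => scalar (FreeMonoid.of l)

theorem monProd_gen_map_some (u : List (Bool ⊕ Bool)) :
    monProd gen (u.map some) = scalar (FreeMonoid.ofList u) := by
  induction u with
  | nil => rfl
  | cons l u ih => simp [monProd_cons, ih, gen]

theorem monProd_gen_building (w : List Bool) :
    monProd gen (w.map (fun c => some (Sum.inl c)) ++ [none]) = point (building w) := by
  induction w with
  | nil => simp [monProd, gen]
  | cons c w ih => simp [monProd_cons, ih, gen, step]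

theorem monProd_gen_closed (w : List Bool) :
    monProd gen (some (Sum.inr false) :: (w.map (fun c => some (Sum.inl c)) ++ [none])) =
      point (closed w) := by
  simp [monProd_cons, monProd_gen_building, gen, step]

/-- The word length with respect to `gen`. -/
def norm : Carrier → ℕ
  | scalar u => u.length
  | point (building w) => w.length + 1
  | point (closed w) => w.length + 2

theorem norm_gen_mul_le (a : Option (Bool ⊕ Bool)) (x : Carrier) :
    norm (gen a * x) ≤ norm x + 1 := by
  rcases a with _ | (c | _ | _) <;> rcases x with u | (w | w) <;>
    simp [gen, norm, step, add_comm 1]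

theorem norm_monProd_gen_le (v : List (Option (Bool ⊕ Bool))) :
    norm (monProd gen v) ≤ v.length := by
  induction v with
  | nil => exact le_rfl
  | cons a v ih =>
    rw [monProd_cons, List.length_cons]
    exact (norm_gen_mul_le a _).trans (by omega)

/-- The normal forms with respect to `gen`. -/
inductive IsNormal : List (Option (Bool ⊕ Bool)) → Prop
  | scalar (u : List (Bool ⊕ Bool)) : IsNormal (u.map some)
  | building (w : List Bool) : IsNormal (w.map (fun c => some (Sum.inl c)) ++ [none])
  | closed (w : List Bool) :
      IsNormal (some (Sum.inr false) :: (w.map (fun c => some (Sum.inl c)) ++ [none]))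

theorem IsNormal.length_eq_norm {w : List (Option (Bool ⊕ Bool))} (h : IsNormal w) :
    w.length = norm (monProd gen w) := by
  cases h with
  | scalar u =>
    rw [monProd_gen_map_some, List.length_map]
    rfl
  | building w => simp [monProd_gen_building, norm]
  | closed w => simp [monProd_gen_closed, norm]

theorem IsNormal.eq_of_monProd_eq {v w : List (Option (Bool ⊕ Bool))} (hv : IsNormal v)
    (hw : IsNormal w) (h : monProd gen v = monProd gen w) : v = w := by
  cases hv <;> cases hw <;>
    simp_all [monProd_gen_map_some, monProd_gen_building, monProd_gen_closed]

theorem exists_isNormal (x : Carrier) : ∃ w, IsNormal w ∧ monProd gen w = x := by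
  rcases x with u | (w | w)
  · exact ⟨_, .scalar u.toList, by simp [monProd_gen_map_some]⟩
  · exact ⟨_, .building w, monProd_gen_building w⟩
  · exact ⟨_, .closed w, monProd_gen_closed w⟩

/-- The states of an automaton that recognises the normal forms. -/
inductive Phase : Type
  | start
  | pushing
  | free
  | final
  | dead

open Classical in
noncomputable instance : Fintype Phase where
  elems := {.start, .pushing, .free, .final, .dead}
  complete p := by cases p <;> simp

/-- The transition function of an automaton that recognises the normal forms. -/
def phaseStep : Phase → Option (Bool ⊕ Bool) → Phase
  | .start, some (Sum.inl _) => .pushing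
  | .start, some (Sum.inr false) => .pushing
  | .start, some (Sum.inr true) => .free
  | .pushing, some (Sum.inl _) => .pushing
  | .pushing, some (Sum.inr _) => .free
  | .free, some _ => .free
  | .start, none => .final
  | .pushing, none => .final
  | _, _ => .dead

/-- An automaton that recognises the normal forms. -/
def normalDFA : DFA (Option (Bool ⊕ Bool)) Phase where
  step := phaseStep
  start := .start
  accept := {.dead}ᶜ

theorem foldl_phaseStep_dead (w : List (Option (Bool ⊕ Bool))) :
    w.foldl phaseStep .dead = .dead := by
  induction w with
  | nil => rfl
  | cons a w ih => simpa [phaseStep] using ih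

theorem foldl_phaseStep_final (w : List (Option (Bool ⊕ Bool))) :
    w.foldl phaseStep .final ≠ .dead ↔ w = [] := by
  cases w <;> simp [phaseStep, foldl_phaseStep_dead]

theorem foldl_phaseStep_free (w : List (Option (Bool ⊕ Bool))) :
    w.foldl phaseStep .free ≠ .dead ↔ none ∉ w := by
  induction w with
  | nil => simp
  | cons a w ih => cases a <;> simp_all [phaseStep, foldl_phaseStep_dead]

theorem foldl_phaseStep_pushing (w : List (Option (Bool ⊕ Bool))) :
    w.foldl phaseStep .pushing ≠ .dead ↔
      none ∉ w ∨ ∃ v : List Bool, w = v.map (fun c => some (Sum.inl c)) ++ [none] := by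
  induction w with
  | nil => simp
  | cons a w ih =>
    rcases a with _ | c | f
    · simp only [List.foldl_cons, phaseStep, foldl_phaseStep_final]
      constructor
      · rintro rfl
        exact .inr ⟨[], rfl⟩
      · rintro (h | ⟨_ | ⟨c, v⟩, h⟩) <;> simp_all
    · simp only [List.foldl_cons, phaseStep, ih, List.mem_cons, reduceCtorEq, false_or]
      refine or_congr_right ⟨?_, ?_⟩
      · rintro ⟨v, rfl⟩
        exact ⟨c :: v, rfl⟩
      · rintro ⟨_ | ⟨d, v⟩, h⟩
        · simp at h
        · exact ⟨v, (List.cons.inj h).2⟩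
    · simp only [List.foldl_cons, phaseStep, foldl_phaseStep_free, List.mem_cons, reduceCtorEq,
        false_or]
      refine ⟨.inl, ?_⟩
      rintro (h | ⟨_ | ⟨d, v⟩, h⟩) <;> simp_all

theorem isNormal_of_none_notMem {w : List (Option (Bool ⊕ Bool))} (h : none ∉ w) :
    IsNormal w := by
  obtain ⟨u, rfl⟩ : w ∈ Set.range (List.map some) := by
    rw [Set.range_list_map]
    exact fun a ha => Option.ne_none_iff_exists.1 fun hn => h (hn ▸ ha)
  exact .scalar u

theorem mem_accepts_normalDFA {w : List (Option (Bool ⊕ Bool))} :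
    w ∈ normalDFA.accepts ↔ w.foldl phaseStep .start ≠ .dead := Iff.rfl

theorem mem_accepts_normalDFA_iff_isNormal {w : List (Option (Bool ⊕ Bool))} :
    w ∈ normalDFA.accepts ↔ IsNormal w := by
  rw [mem_accepts_normalDFA]
  constructor
  · intro h
    rcases w with _ | ⟨_ | c | _ | _, w⟩
    · exact .scalar []
    · obtain rfl := (foldl_phaseStep_final w).1 h
      exact .building []
    · obtain h | ⟨v, rfl⟩ := (foldl_phaseStep_pushing w).1 h
      · exact isNormal_of_none_notMem (by simpa using h)
      · exact .building (c :: v)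
    · obtain h | ⟨v, rfl⟩ := (foldl_phaseStep_pushing w).1 h
      · exact isNormal_of_none_notMem (by simpa using h)
      · exact .closed v
    · exact isNormal_of_none_notMem (by simpa using (foldl_phaseStep_free w).1 h)
  · rintro (u | w | w)
    · rcases u with _ | ⟨c | _ | _, u⟩
      · simp
      · exact (foldl_phaseStep_pushing _).2 (.inl (by simp))
      · exact (foldl_phaseStep_pushing _).2 (.inl (by simp))
      · exact (foldl_phaseStep_free _).2 (by simp)
    · rcases w with _ | ⟨c, w⟩
      · simp [phaseStep]
      · exact (foldl_phaseStep_pushing _).2 (.inr ⟨w, rfl⟩)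
    · exact (foldl_phaseStep_pushing _).2 (.inr ⟨w, rfl⟩)

theorem isRobustMonMarkovLang_gen : IsRobustMonMarkovLang gen normalDFA.accepts where
  regular := ⟨Phase, inferInstance, normalDFA, rfl⟩
  prefix_closed u v h := by
    rw [mem_accepts_normalDFA] at h ⊢
    intro hu
    rw [List.foldl_append, hu, foldl_phaseStep_dead] at h
    exact h rfl
  unique_rep x := by
    obtain ⟨w, hw, rfl⟩ := exists_isNormal x
    refine ⟨w, ⟨mem_accepts_normalDFA_iff_isNormal.2 hw, rfl⟩, ?_⟩
    rintro v ⟨hv, h⟩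
    exact (mem_accepts_normalDFA_iff_isNormal.1 hv).eq_of_monProd_eq hw h
  min_length w hw v h := by
    rw [(mem_accepts_normalDFA_iff_isNormal.1 hw).length_eq_norm, ← h]
    exact norm_monProd_gen_le v

theorem surjective_monProd_gen : Surjective (monProd gen) := fun x =>
  (exists_isNormal x).imp fun _ h => h.2

/-! ### The generating set without a robust Markov language -/

/-- The generators `gen` together with the square of the letter `inl true`. -/
def genSq : Option (Option (Bool ⊕ Bool)) → Carrier
  | none => point (building [])
  | some none => scalar (FreeMonoid.of (Sum.inl true) * FreeMonoid.of (Sum.inl true))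
  | some (some l) => scalar (FreeMonoid.of l)

theorem surjective_monProd_genSq : Surjective (monProd genSq) := by
  intro x
  obtain ⟨w, rfl⟩ := surjective_monProd_gen x
  refine ⟨w.map (Option.map some), ?_⟩
  rw [monProd, monProd, List.map_map]
  congr 2
  funext a
  cases a <;> rfl

/-- The generator that prepends a letter (`some c`) or the square of `true` (`none`). -/
def pushGen : Option Bool → Option (Option (Bool ⊕ Bool)) := fun o => some (o.map Sum.inl)

/-- The word prepended by a sequence of generators `pushGen`. -/
def expand (u : List (Option Bool)) : List Bool :=
  u.flatMap fun o => o.elim [true, true] fun c => [c]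

@[simp] theorem expand_nil : expand [] = [] := rfl

@[simp] theorem expand_none_cons (u : List (Option Bool)) :
    expand (none :: u) = true :: true :: expand u := rfl

@[simp] theorem expand_some_cons (c : Bool) (u : List (Option Bool)) :
    expand (some c :: u) = c :: expand u := rfl

theorem two_mul_length (u : List (Option Bool)) :
    2 * u.length = (expand u).count true + 2 * (expand u).count false + u.count (some true) := by
  induction u with
  | nil => simp
  | cons o u ih => rcases o with _ | _ | _ <;> simp <;> omega

theorem eq_of_expand_eq {u v : List (Option Bool)} (hu : some true ∉ u) (hv : some true ∉ v)
    (h : expand u = expand v) : u = v := by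
  induction u generalizing v with
  | nil => rcases v with _ | ⟨_ | _ | _, v⟩ <;> simp_all
  | cons o u ih =>
    rcases o with _ | _ | _ <;> rcases v with _ | ⟨_ | _ | _, v⟩ <;> simp at hu hv h
    all_goals rw [ih hu hv h]

theorem expand_append (u v : List (Option Bool)) : expand (u ++ v) = expand u ++ expand v :=
  List.flatMap_append

theorem expand_replicate_some (c : Bool) (n : ℕ) :
    expand (List.replicate n (some c)) = List.replicate n c := by
  induction n with
  | zero => rfl
  | succ n ih => simp [List.replicate_succ, ih]

theorem expand_replicate_none (n : ℕ) :
    expand (List.replicate n none) = List.replicate (2 * n) true := by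
  induction n with
  | zero => rfl
  | succ n ih => simp [List.replicate_succ, ih, Nat.mul_succ]

theorem monProd_genSq_building (u : List (Option Bool)) (v : List (Option (Option (Bool ⊕ Bool)))) :
    monProd genSq (u.map pushGen ++ none :: v) = point (building (expand u)) := by
  induction u with
  | nil => simp [monProd_cons, genSq]
  | cons o u ih => cases o <;> simp [monProd_cons, ih, genSq, pushGen, mul_smul, step]

theorem monProd_genSq_closed (f : Bool) (u : List (Option Bool)) :
    monProd genSq (some (some (Sum.inr f)) :: (u.map pushGen ++ [none])) =
      point (closed (bif f then (expand u).map not else expand u)) := by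
  simp [monProd_cons, monProd_genSq_building, genSq, step]

theorem exists_of_monProd_genSq_eq_building {v : List (Option (Option (Bool ⊕ Bool)))}
    {w : List Bool} (h : monProd genSq v = point (building w)) :
    ∃ u v', v = u.map pushGen ++ none :: v' ∧ expand u = w := by
  induction v generalizing w with
  | nil => simp [monProd_nil, one_def] at h
  | cons a v ih =>
    rw [monProd_cons] at h
    rcases a with _ | a
    · exact ⟨[], v, rfl, by simpa [genSq] using h⟩
    generalize hx : monProd genSq v = x at h ih
    rcases a with _ | c | f <;> rcases x with _ | z | z <;>
      simp [genSq, mul_smul, step] at h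
    · obtain ⟨u, v', rfl, rfl⟩ := ih rfl
      exact ⟨none :: u, v', rfl, h⟩
    · obtain ⟨u, v', rfl, rfl⟩ := ih rfl
      exact ⟨some c :: u, v', rfl, h⟩

theorem exists_of_monProd_genSq_eq_closed {v : List (Option (Option (Bool ⊕ Bool)))}
    {w : List Bool} (h : monProd genSq v = point (closed w)) :
    ∃ p f u v', v = p ++ some (some (Sum.inr f)) :: (u.map pushGen ++ none :: v') ∧
      (bif f then (expand u).map not else expand u) = w := by
  induction v generalizing w with
  | nil => simp [monProd_nil, one_def] at h
  | cons a v ih =>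
    rw [monProd_cons] at h
    generalize hx : monProd genSq v = x at h ih
    rcases a with _ | _ | c | f <;> rcases x with _ | z | z <;>
      simp [genSq, mul_smul, step] at h
    all_goals first
      | obtain ⟨u, v', rfl, rfl⟩ := exists_of_monProd_genSq_eq_building hx
        exact ⟨[], f, u, v', rfl, h⟩
      | obtain ⟨p, g, u, v', rfl, rfl⟩ := ih rfl
        exact ⟨_ :: p, g, u, v', rfl, h⟩

/-- The word over `genSq` that builds `true ^ (2 * m) * false ^ (2 * k)` and seals it unchanged. -/
def plainWord (m k : ℕ) : List (Option (Option (Bool ⊕ Bool))) :=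
  some (some (Sum.inr false)) ::
    ((List.replicate m none ++ List.replicate (2 * k) (some false)).map pushGen ++ [none])

theorem monProd_plainWord (m k : ℕ) :
    monProd genSq (plainWord m k) =
      point (closed (List.replicate (2 * m) true ++ List.replicate (2 * k) false)) := by
  rw [plainWord, monProd_genSq_closed, expand_append, expand_replicate_some,
    expand_replicate_none, cond_false]

theorem length_plainWord (m k : ℕ) : (plainWord m k).length = m + 2 * k + 2 := by
  simp [plainWord, add_assoc]

theorem plainWord_notMem {L : Language (Option (Option (Bool ⊕ Bool)))}
    (hL : IsRobustMonMarkovLang genSq L) {m k : ℕ} (hmk : m < k) : plainWord m k ∉ L := by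
  intro h
  have := hL.min_length _ h (some (some (Sum.inr true)) ::
    ((List.replicate (2 * m) (some false) ++ List.replicate k none).map pushGen ++ [none])) (by
      rw [monProd_genSq_closed, monProd_plainWord]
      simp [expand_append, expand_replicate_some, expand_replicate_none])
  rw [length_plainWord] at this
  simp at this
  omega

theorem eq_plainWord {m k : ℕ} (hkm : k < m) {w : List (Option (Option (Bool ⊕ Bool)))}
    (h : monProd genSq w = monProd genSq (plainWord m k))
    (hlen : w.length ≤ (plainWord m k).length) : w = plainWord m k := by
  rw [monProd_plainWord] at h
  rw [length_plainWord] at hlen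
  obtain ⟨p, f, u, v, rfl, hu⟩ := exists_of_monProd_genSq_eq_closed h
  simp only [List.length_append, List.length_cons, List.length_map] at hlen
  have hcount := two_mul_length u
  cases f with
  | true =>
    have hu' : expand u = List.replicate (2 * m) false ++ List.replicate (2 * k) true := by
      simpa [Function.comp_def] using congrArg (List.map not) hu
    simp [hu', List.count_replicate] at hcount
    omega
  | false =>
    replace hu : expand u = _ := hu
    simp [hu, List.count_replicate] at hcount
    obtain rfl : p = [] := List.length_eq_zero_iff.1 (by omega)
    obtain rfl : v = [] := List.length_eq_zero_iff.1 (by omega)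
    have hnot : some true ∉ u := List.count_eq_zero.1 (by simp at hlen; omega)
    have : u = List.replicate m none ++ List.replicate (2 * k) (some false) :=
      eq_of_expand_eq hnot (by simp) (by
        rw [hu, expand_append, expand_replicate_some, expand_replicate_none])
    rw [this]
    rfl

theorem plainWord_mem {L : Language (Option (Option (Bool ⊕ Bool)))}
    (hL : IsRobustMonMarkovLang genSq L) {m k : ℕ} (hkm : k < m) : plainWord m k ∈ L := by
  obtain ⟨w, ⟨hw, h⟩, -⟩ := hL.unique_rep (monProd genSq (plainWord m k))
  exact eq_plainWord hkm h (hL.min_length w hw _ h.symm) ▸ hw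

theorem not_isRobustMonMarkovLang_genSq (L : Language (Option (Option (Bool ⊕ Bool)))) :
    ¬ IsRobustMonMarkovLang genSq L := by
  intro hL
  obtain ⟨Q, _, D, hD⟩ := hL.regular
  let start (n : ℕ) : List (Option (Option (Bool ⊕ Bool))) :=
    some (some (Sum.inr false)) :: (List.replicate (2 * n) none).map pushGen
  have hstart (n k : ℕ) : plainWord (2 * n) k =
      start n ++ ((List.replicate (2 * k) (some false)).map pushGen ++ [none]) := by
    simp [plainWord, start]
  have hsep {n n' : ℕ} (h : n < n') : D.eval (start n) ≠ D.eval (start n') := by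
    intro heq
    have hout := plainWord_notMem hL (Nat.lt_succ_self (2 * n))
    have hin := plainWord_mem hL (m := 2 * n') (k := 2 * n + 1) (by omega)
    rw [← hD, hstart, DFA.mem_accepts] at hin hout
    refine hout ?_
    rwa [DFA.eval, D.evalFrom_of_append, ← DFA.eval, heq, DFA.eval, ← D.evalFrom_of_append]
  obtain ⟨n, n', hne, heq⟩ := Finite.exists_ne_map_eq_of_infinite fun n => D.eval (start n)
  rcases hne.lt_or_gt with h | h
  · exact hsep h heq
  · exact hsep h heq.symm

end RobustMarkov

/-- There is a finitely generated monoid that is robustly Markov with respect to some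
finite generating alphabet, but not strongly Markov: over some finite generating
alphabet `B` it admits no robust monoid Markov language. -/
theorem stmt11 : ∃ (M : Type) (inst : Monoid M),
    @Monoid.FG M inst ∧ @MonRobustlyMarkov M inst ∧
    ∃ (B : Type) (_ : Fintype B) (ψ : B → M),
      Surjective (@monProd B M inst ψ) ∧
      ¬ ∃ L : Language B, @IsRobustMonMarkovLang B M inst ψ L := by
  exact ⟨RobustMarkov.Carrier, inferInstance,
    RobustMarkov.fg_of_surjective_monProd RobustMarkov.surjective_monProd_gen,
    ⟨_, inferInstance, RobustMarkov.gen, RobustMarkov.surjective_monProd_gen, _,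
      RobustMarkov.isRobustMonMarkovLang_gen⟩,
    _, inferInstance, RobustMarkov.genSq, RobustMarkov.surjective_monProd_genSq,
    fun ⟨L, hL⟩ => RobustMarkov.not_isRobustMonMarkovLang_genSq L hL⟩
end
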